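/- For every t ≥ 4, every γ₁, δ₁, γ₂, δ₂ with γ₁+2δ₁ = γ₂+2δ₂ = t+1 and δ₁, δ₂ ≥ 1, and every γ, δ with δ ∈ {max(δ₁,δ₂), …, δ₁+δ₂−1} and max(δ, max(γ₁+δ₁, γ₂+δ₂)) ≤ γ+δ ≤ γ₁+γ₂+δ₁+δ₂−1, there exist two quaternary linear perfect codes C₁ and C₂ of length 2^(t−1), of dual type (0,2^(t−1);γ₁,δ₁) and (0,2^(t−1);γ₂,δ₂) respectively, such that C₁ ∩ C₂ is of dual type (0,2^(t−1);γ,δ). -/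

import Mathlib

open scoped BigOperators

/-- `Z2` is the ring of integers modulo 2. -/
abbrev Z2 : Type := ZMod 2

/-- `Z4` is the ring of integers modulo 4. -/
abbrev Z4 : Type := ZMod 4

/-- The ambient group `Z₂^α × Z₄^β` for additive codes. -/
abbrev Amb (α β : ℕ) : Type := (Fin α → Z2) × (Fin β → Z4)

/-- The inner product on `Z₂^α × Z₄^β`:
`⟨u,v⟩ = 2·(Σᵢ ūᵢ·v̄ᵢ) + Σⱼ uⱼ·vⱼ ∈ Z₄`, where the bar denotes the lift `0 ↦ 0`, `1 ↦ 1`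
of binary coordinates into `Z₄`. -/
def addInner {α β : ℕ} (u v : Amb α β) : Z4 :=
  2 * (∑ i, ((u.1 i).val : Z4) * ((v.1 i).val : Z4)) + ∑ j, u.2 j * v.2 j

lemma addInner_zero_left {α β : ℕ} (v : Amb α β) : addInner 0 v = 0 := by
  simp [addInner]

lemma addInner_add_left {α β : ℕ} (u u' v : Amb α β) :
    addInner (u + u') v = addInner u v + addInner u' v := by
  have key : ∀ x x' y : Z2,
      (2 : Z4) * ((((x + x').val : ℕ) : Z4) * ((y.val : ℕ) : Z4)) =
        2 * (((x.val : ℕ) : Z4) * ((y.val : ℕ) : Z4)) +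
          2 * (((x'.val : ℕ) : Z4) * ((y.val : ℕ) : Z4)) := by decide
  simp only [addInner, Prod.fst_add, Prod.snd_add, Pi.add_apply, add_mul,
    Finset.mul_sum, Finset.sum_add_distrib]
  rw [Finset.sum_congr rfl (fun i _ => key (u.1 i) (u'.1 i) (v.1 i)),
    Finset.sum_add_distrib]
  ring

lemma addInner_neg_left {α β : ℕ} (u v : Amb α β) :
    addInner (-u) v = - addInner u v := by
  have hn : ∀ x : Z2, (-x) = x := by decide
  have key : ∀ S T : Z4, 2 * S + -T = -(2 * S + T) := by decide
  simp only [addInner, Prod.fst_neg, Prod.snd_neg, Pi.neg_apply, hn, neg_mul]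
  rw [Finset.sum_neg_distrib]
  exact key _ _

/-- The additive dual `C^⊥ = {u : ⟨u,v⟩ = 0 for all v ∈ C}` of an additive code `C`. -/
def dualCode {α β : ℕ} (C : AddSubgroup (Amb α β)) : AddSubgroup (Amb α β) where
  carrier := {u | ∀ v ∈ C, addInner u v = 0}
  zero_mem' := fun v _ => addInner_zero_left v
  add_mem' := by
    intro a b ha hb v hv
    rw [addInner_add_left, ha v hv, hb v hv, add_zero]
  neg_mem' := by
    intro a ha v hv
    rw [addInner_neg_left, ha v hv, neg_zero]

/-- An additive code `C ⊆ Z₂^α × Z₄^β` is of type `(α,β;γ,δ)` when it is isomorphic,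
as an abelian group, to `Z₂^γ × Z₄^δ`; equivalently (which is how we state it),
`|C| = 2^(γ+2δ)` and the number of elements `x ∈ C` with `x + x = 0` is `2^(γ+δ)`. -/
def isOfType {α β : ℕ} (C : AddSubgroup (Amb α β)) (γ δ : ℕ) : Prop :=
  Nat.card C = 2 ^ (γ + 2 * δ) ∧
    Nat.card {x : Amb α β // x ∈ C ∧ x + x = 0} = 2 ^ (γ + δ)

/-- An additive code `C` is of type `(α,β;γ,δ;κ)` when it is of type `(α,β;γ,δ)` and
`2^κ` is the cardinality of the image of `{x ∈ C : x + x = 0}` under the projection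
onto the binary coordinates. -/
def isOfTypeK {α β : ℕ} (C : AddSubgroup (Amb α β)) (γ δ κ : ℕ) : Prop :=
  isOfType C γ δ ∧
    Nat.card ↥(Prod.fst '' {x : Amb α β | x ∈ C ∧ x + x = 0}) = 2 ^ κ

/-- The Gray map on one quaternary coordinate:
`0 ↦ (0,0)`, `1 ↦ (0,1)`, `2 ↦ (1,1)`, `3 ↦ (1,0)`. -/
def grayPhi (y : Z4) : Z2 × Z2 :=
  if y = 0 then (0, 0) else if y = 1 then (0, 1) else if y = 2 then (1, 1) else (1, 0)

/-- The Gray map `Φ : Z₂^α × Z₄^β → Z₂^(α+2β)` (with index set `Fin α ⊕ Fin β × Fin 2`),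
acting as the identity on the binary coordinates and as `grayPhi` coordinatewise on the
quaternary coordinates. -/
def grayMap {α β : ℕ} (u : Amb α β) : (Fin α ⊕ Fin β × Fin 2) → Z2 :=
  Sum.elim (fun a => u.1 a)
    (fun b => if b.2 = 0 then (grayPhi (u.2 b.1)).1 else (grayPhi (u.2 b.1)).2)

/-- The minimum Hamming distance of a binary code `S` equals `d`. -/
def minDistEq {ι : Type} [Fintype ι] (S : Set (ι → Z2)) (d : ℕ) : Prop :=
  (∀ x ∈ S, ∀ y ∈ S, x ≠ y → d ≤ hammingDist x y) ∧
    ∃ x ∈ S, ∃ y ∈ S, x ≠ y ∧ hammingDist x y = d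

/-- A quaternary linear perfect code of length `β = 2^(t-1)` (`t ≥ 3`): an additive
subgroup of `Z₄^β` whose Gray image has cardinality `2^(2β-t-1)` and minimum Hamming
distance `4`. -/
def isQuatPerfect (t β : ℕ) (C : AddSubgroup (Amb 0 β)) : Prop :=
  3 ≤ t ∧ β = 2 ^ (t - 1) ∧
    Nat.card ↥(grayMap '' (C : Set (Amb 0 β))) = 2 ^ (2 * β - t - 1) ∧
    minDistEq (grayMap '' (C : Set (Amb 0 β))) 4

/-- An additive extended perfect code with `α ≠ 0` and binary length `α + 2β = 2^t`:
an additive subgroup of `Z₂^α × Z₄^β` with `α ≥ 1` whose Gray image has cardinality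
`2^(2^t - t - 1)` and minimum Hamming distance `4`. -/
def isAddExtPerfect (t α β : ℕ) (C : AddSubgroup (Amb α β)) : Prop :=
  1 ≤ α ∧ α + 2 * β = 2 ^ t ∧
    Nat.card ↥(grayMap '' (C : Set (Amb α β))) = 2 ^ (2 ^ t - t - 1) ∧
    minDistEq (grayMap '' (C : Set (Amb α β))) 4

theorem addInner_eq_sum {N : ℕ} (u v : Amb 0 N) : addInner u v = ∑ j, u.2 j * v.2 j := by
  simp [addInner]

theorem addInner_comm {N : ℕ} (u v : Amb 0 N) : addInner u v = addInner v u := by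
  simp only [addInner_eq_sum, mul_comm]

/-- Pairing with `u`, as an additive homomorphism. -/
def innerHom {N : ℕ} (u : Amb 0 N) : Amb 0 N →+ Z4 where
  toFun v := addInner u v
  map_zero' := by rw [addInner_comm, addInner_zero_left]
  map_add' v w := by
    rw [addInner_comm, addInner_add_left, addInner_comm v, addInner_comm w]

/-- Pairing with `u`, as a character with values in `Z₄`. -/
def innerChar {N : ℕ} (u : Amb 0 N) : Multiplicative (Amb 0 N) →* (Multiplicative Z4)ˣ :=
  (toUnits : Multiplicative Z4 ≃* _).toMonoidHom.comp (AddMonoidHom.toMultiplicative (innerHom u))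

theorem innerChar_apply_eq_one_iff {N : ℕ} (u v : Amb 0 N) :
    innerChar u (Multiplicative.ofAdd v) = 1 ↔ addInner u v = 0 := by
  simp only [innerChar, MonoidHom.comp_apply]
  exact (toUnits : Multiplicative Z4 ≃* _).map_eq_one_iff

theorem innerChar_bijective {N : ℕ} : Function.Bijective (innerChar (N := N)) := by
  constructor
  · intro u v h
    have key : ∀ w : Amb 0 N, addInner u w = addInner v w := fun w =>
      (toUnits : Multiplicative Z4 ≃* _).injective (DFunLike.congr_fun h (Multiplicative.ofAdd w))
    refine Prod.ext (Subsingleton.elim _ _) (funext fun j => ?_)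
    simpa [addInner_eq_sum, Pi.single_apply] using key (0, Pi.single j 1)
  · intro φ
    let ψ : Amb 0 N →+ Z4 := MonoidHom.toAdditive
      ((toUnits : Multiplicative Z4 ≃* _).symm.toMonoidHom.comp φ)
    refine ⟨(0, fun j => ψ (0, Pi.single j 1)), MonoidHom.ext fun v => ?_⟩
    have key : innerHom (0, fun j => ψ (0, Pi.single j 1)) = ψ := by
      refine AddMonoidHom.ext fun w => ?_
      have hw : w = ∑ j, (w.2 j).val • ((0, Pi.single j 1) : Amb 0 N) := by
        refine Prod.ext (Subsingleton.elim _ _) (funext fun j => ?_)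
        rw [Prod.snd_sum, Finset.sum_apply, Finset.sum_eq_single j]
        · rw [Prod.smul_snd, Pi.smul_apply]
          simp only [Pi.single_eq_same]
          rw [nsmul_one, ZMod.natCast_zmod_val]
        · intro i _ hi
          simp [Pi.single_eq_of_ne hi.symm]
        · simp
      conv_rhs => rw [hw]
      simp only [map_sum, map_nsmul, innerHom, AddMonoidHom.coe_mk, ZeroHom.coe_mk,
        addInner_eq_sum]
      refine Finset.sum_congr rfl fun j _ => ?_
      rw [nsmul_eq_mul, ZMod.natCast_zmod_val, mul_comm]
    refine (toUnits : Multiplicative Z4 ≃* _).symm.injective ?_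
    exact DFunLike.congr_fun key v.toAdd

instance hasEnoughRootsOfUnity_four : HasEnoughRootsOfUnity (Multiplicative Z4) 4 where
  prim := ⟨Multiplicative.ofAdd 1, by
    have h : orderOf (Multiplicative.ofAdd (1 : Z4)) = 4 := by
      rw [orderOf_ofAdd_eq_addOrderOf, ZMod.addOrderOf_one]
    have h' := IsPrimitiveRoot.orderOf (Multiplicative.ofAdd (1 : Z4))
    rwa [h] at h'⟩
  cyc :=
    have : IsCyclic (Multiplicative Z4)ˣ :=
      isCyclic_of_surjective (toUnits : Multiplicative Z4 ≃* _) toUnits.surjective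
    inferInstance

theorem hasEnoughRootsOfUnity_exponent (N : ℕ) : HasEnoughRootsOfUnity (Multiplicative Z4)
    (Monoid.exponent (Multiplicative (Amb 0 N))) := by
  refine HasEnoughRootsOfUnity.of_dvd (n := 4) _ (Monoid.exponent_dvd_of_forall_pow_eq_one ?_)
  intro g
  have h : ∀ z : Z4, 4 • z = 0 := by decide
  have : 4 • g.toAdd = 0 :=
    Prod.ext (Subsingleton.elim _ _) (funext fun j => h _)
  exact this

theorem dualCode_dualCode {N : ℕ} (D : AddSubgroup (Amb 0 N)) : dualCode (dualCode D) = D := by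
  have := hasEnoughRootsOfUnity_exponent N
  ext x
  have key := CommGroup.forall_monoidHom_apply_eq_one_iff (Multiplicative Z4)
    (AddSubgroup.toSubgroup D) (Multiplicative.ofAdd x)
  rw [innerChar_bijective.surjective.forall] at key
  simp only [innerChar_apply_eq_one_iff] at key
  refine Iff.trans ?_ key
  refine forall_congr' fun u => ?_
  rw [addInner_comm]
  refine imp_congr_left (forall_congr' fun v => ?_)
  exact imp_congr_right fun _ => (innerChar_apply_eq_one_iff u v).symm

theorem card_dualCode_mul_card {N : ℕ} (D : AddSubgroup (Amb 0 N)) :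
    Nat.card (dualCode D) * Nat.card D = 4 ^ N := by
  have := hasEnoughRootsOfUnity_exponent N
  have key := CommGroup.card_domRestrictHom_ker (Multiplicative Z4) (AddSubgroup.toSubgroup D)
  have e : dualCode D ≃ (MonoidHom.domRestrictHom (AddSubgroup.toSubgroup D)
      (Multiplicative Z4)ˣ).ker := by
    refine (Equiv.ofBijective _ innerChar_bijective).subtypeEquiv fun u => ?_
    rw [MonoidHom.mem_ker, MonoidHom.domRestrictHom_apply, MonoidHom.domRestrict_eq_one_iff]
    exact forall_congr' fun v => imp_congr_right fun _ => (innerChar_apply_eq_one_iff u v).symm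
  have hG : Nat.card (Multiplicative (Amb 0 N)) = 4 ^ N := by
    rw [Nat.card_congr Multiplicative.toAdd]
    simp
  have hD : Nat.card (AddSubgroup.toSubgroup D) = Nat.card D := rfl
  rw [Nat.card_congr e, key, ← hG,
    Subgroup.card_eq_card_quotient_mul_card_subgroup (AddSubgroup.toSubgroup D), hD]

theorem dualCode_sup {N : ℕ} (D E : AddSubgroup (Amb 0 N)) :
    dualCode (D ⊔ E) = dualCode D ⊓ dualCode E := by
  ext u
  constructor
  · exact fun h => ⟨fun v hv => h v (AddSubgroup.mem_sup_left hv),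
      fun v hv => h v (AddSubgroup.mem_sup_right hv)⟩
  · rintro ⟨hD, hE⟩ v hv
    have hle : D ⊔ E ≤ (innerHom u).ker := sup_le hD hE
    exact hle hv

/-- Reduction modulo two. -/
def red : Z4 →+* Z2 := ZMod.castHom (by norm_num) Z2

/-- The embedding `x ↦ 2x` of `Z₂` into `Z₄`. -/
def dbl : Z2 →+ Z4 where
  toFun x := 2 * (x.val : Z4)
  map_zero' := by decide
  map_add' := by decide

/-- The lift `0 ↦ 0`, `1 ↦ 1` of `Z₂` into `Z₄`. -/
def lift (x : Z2) : Z4 := (x.val : Z4)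

theorem red_dbl (x : Z2) : red (dbl x) = 0 := by revert x; decide

theorem red_lift (x : Z2) : red (lift x) = x := by revert x; decide

theorem dbl_mul (x : Z2) (z : Z4) : dbl x * z = dbl (x * red z) := by revert z x; decide

theorem dbl_eq_zero {x : Z2} : dbl x = 0 ↔ x = 0 := by revert x; decide

theorem exists_dbl_of_red_eq_zero {z : Z4} (h : red z = 0) : ∃ x, dbl x = z := by
  revert z; decide

section Generators

variable {N : ℕ} {ι κ : Type} [Fintype ι] [Fintype κ]

/-- Linear combinations of generators of order four and of doubled generators. -/
def combHom (v : ι → Fin N → Z4) (w : κ → Fin N → Z2) : (ι → Z4) × (κ → Z2) →+ Amb 0 N where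
  toFun c := (0, fun p => ∑ i, c.1 i * v i p + ∑ j, dbl (c.2 j * w j p))
  map_zero' := by ext <;> simp
  map_add' c d := by
    refine Prod.ext (Subsingleton.elim _ _) (funext fun p => ?_)
    simp only [Prod.fst_add, Prod.snd_add, Pi.add_apply, add_mul, map_add,
      Finset.sum_add_distrib]
    abel

/-- The subgroup generated by the words `v i` and the doubled words `2 w j`. -/
def genCode (v : ι → Fin N → Z4) (w : κ → Fin N → Z2) : AddSubgroup (Amb 0 N) :=
  AddSubgroup.closure (Set.range (fun i => ((0, v i) : Amb 0 N)) ∪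
    Set.range (fun j => ((0, fun p => dbl (w j p)) : Amb 0 N)))

theorem range_combHom (v : ι → Fin N → Z4) (w : κ → Fin N → Z2) :
    (combHom v w).range = genCode v w := by
  classical
  apply le_antisymm
  · rintro _ ⟨c, rfl⟩
    have h : combHom v w c = ∑ i, (c.1 i).val • ((0, v i) : Amb 0 N) +
        ∑ j, (c.2 j).val • ((0, fun p => dbl (w j p)) : Amb 0 N) := by
      refine Prod.ext (Subsingleton.elim _ _) (funext fun p => ?_)
      simp only [combHom, AddMonoidHom.coe_mk, ZeroHom.coe_mk, Prod.snd_add, Prod.snd_sum,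
        Pi.add_apply, Finset.sum_apply, Prod.smul_snd, Pi.smul_apply]
      congr 1
      · exact Finset.sum_congr rfl fun i _ => by rw [nsmul_eq_mul, ZMod.natCast_zmod_val]
      · refine Finset.sum_congr rfl fun j _ => ?_
        rw [← map_nsmul, nsmul_eq_mul, ZMod.natCast_zmod_val]
    rw [h]
    refine add_mem (sum_mem fun i _ => nsmul_mem ?_ _) (sum_mem fun j _ => nsmul_mem ?_ _)
    · exact AddSubgroup.subset_closure (Or.inl ⟨i, rfl⟩)
    · exact AddSubgroup.subset_closure (Or.inr ⟨j, rfl⟩)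
  · rw [genCode, AddSubgroup.closure_le]
    rintro _ (⟨i, rfl⟩ | ⟨j, rfl⟩)
    · refine ⟨(Pi.single i 1, 0), Prod.ext (Subsingleton.elim _ _) (funext fun p => ?_)⟩
      simp [combHom, Pi.single_apply]
    · refine ⟨(0, Pi.single j 1), Prod.ext (Subsingleton.elim _ _) (funext fun p => ?_)⟩
      simp [combHom, Pi.single_apply, apply_ite dbl]

theorem combHom_injective {v : ι → Fin N → Z4} {w : κ → Fin N → Z2}
    (hind : ∀ (a : ι → Z2) (b : κ → Z2),
      (∀ p, ∑ i, a i * red (v i p) + ∑ j, b j * w j p = 0) → a = 0 ∧ b = 0) :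
    Function.Injective (combHom v w) := by
  rw [injective_iff_map_eq_zero]
  rintro ⟨a, b⟩ h
  have hp : ∀ p, ∑ i, a i * v i p + ∑ j, dbl (b j * w j p) = 0 := fun p =>
    congrFun (congrArg Prod.snd h) p
  have ha : ∀ i, red (a i) = 0 := by
    have := (hind (fun i => red (a i)) 0 fun p => by
      simpa [red_dbl] using congrArg red (hp p)).1
    exact fun i => congrFun this i
  choose a' ha' using fun i => exists_dbl_of_red_eq_zero (ha i)
  obtain rfl : a = fun i => dbl (a' i) := funext fun i => (ha' i).symm
  obtain ⟨rfl, rfl⟩ := hind a' b fun p => by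
    rw [← dbl_eq_zero, map_add, map_sum, map_sum, ← hp p]
    simp only [dbl_mul]
  ext <;> simp

theorem isOfType_genCode {v : ι → Fin N → Z4} {w : κ → Fin N → Z2}
    (hind : ∀ (a : ι → Z2) (b : κ → Z2),
      (∀ p, ∑ i, a i * red (v i p) + ∑ j, b j * w j p = 0) → a = 0 ∧ b = 0) :
    isOfType (genCode v w) (Fintype.card κ) (Fintype.card ι) := by
  have hinj := combHom_injective hind
  rw [← range_combHom]
  constructor
  · rw [← Nat.card_congr (AddMonoidHom.ofInjective hinj).toEquiv]
    have h4 : ∀ k, 4 ^ k = 2 ^ (2 * k) := fun k => by rw [pow_mul]; norm_num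
    simp [pow_add, Nat.card_pi, h4, mul_comm]
  · let f : (ι → {z : Z4 // z + z = 0}) × (κ → Z2) →
        {x : Amb 0 N // x ∈ (combHom v w).range ∧ x + x = 0} := fun c =>
      ⟨combHom v w (fun i => (c.1 i).1, c.2), ⟨_, rfl⟩, by
        rw [← map_add]
        convert map_zero (combHom v w)
        refine Prod.ext (funext fun i => (c.1 i).2) (funext fun j => ?_)
        exact CharTwo.add_self_eq_zero _⟩
    have hf : Function.Bijective f := by
      constructor
      · rintro ⟨a, b⟩ ⟨a', b'⟩ h
        have h' := hinj (congrArg Subtype.val h)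
        simp only [Prod.mk.injEq] at h' ⊢
        exact ⟨funext fun i => Subtype.ext (congrFun h'.1 i), h'.2⟩
      · rintro ⟨_, ⟨c, rfl⟩, h⟩
        rw [← map_add, ← map_zero (combHom v w)] at h
        have hc := congrArg Prod.fst (hinj h)
        exact ⟨(fun i => ⟨c.1 i, congrFun hc i⟩, c.2), rfl⟩
    rw [← Nat.card_congr (Equiv.ofBijective f hf)]
    have hcard : Nat.card {z : Z4 // z + z = 0} = 2 := by
      rw [Nat.card_eq_fintype_card]
      decide
    rw [Nat.card_prod, Nat.card_pi, hcard]
    simp [pow_add, Nat.card_pi, mul_comm]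

end Generators

section Edges

variable {ι : Type} [Fintype ι] [DecidableEq ι]

/-- The indicator function of the edge `{e_{σ i}, e_i + e_{σ i}}` of the binary cube. -/
def edgeFun (σ : Equiv.Perm ι) (i : ι) (x : ι → Z2) : Z2 :=
  if x = Pi.single (σ i) 1 ∨ x = Pi.single i 1 + Pi.single (σ i) 1 then 1 else 0

variable {σ : Equiv.Perm ι}

theorem edgeFun_eq_one_iff {i : ι} {x : ι → Z2} : edgeFun σ i x = 1 ↔
    x = Pi.single (σ i) 1 ∨ x = Pi.single i 1 + Pi.single (σ i) 1 := by
  unfold edgeFun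
  split_ifs with h <;> simp [h]

theorem edgeFun_eq_zero_or_one (i : ι) (x : ι → Z2) : edgeFun σ i x = 0 ∨ edgeFun σ i x = 1 := by
  unfold edgeFun
  split_ifs <;> simp

theorem edgeFun_zero (i : ι) (h : σ i ≠ i) : edgeFun σ i 0 = 0 := by
  refine if_neg ?_
  rintro (h' | h') <;> have := congrFun h' (σ i) <;> simp [h] at this

theorem edgeFun_add_single {i : ι} {x : ι → Z2} (h : edgeFun σ i x = 1) :
    edgeFun σ i (x + Pi.single i 1) = 1 := by
  rw [edgeFun_eq_one_iff] at h ⊢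
  rcases h with rfl | rfl
  · exact Or.inr (add_comm _ _)
  · left
    rw [add_right_comm, ← Pi.single_add, CharTwo.add_self_eq_zero, Pi.single_zero, zero_add]

theorem edgeFun_disjoint (h1 : ∀ i, σ i ≠ i) (h2 : ∀ i, σ (σ i) ≠ i) {i j : ι} {x : ι → Z2}
    (hi : edgeFun σ i x = 1) (hj : edgeFun σ j x = 1) : i = j := by
  have key : ∀ i j : ι, (Pi.single (σ i) 1 : ι → Z2) ≠ Pi.single j 1 + Pi.single (σ j) 1 := by
    intro i j h
    have e1 := congrFun h j
    have e2 := congrFun h (σ j)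
    simp only [Pi.add_apply, Pi.single_apply] at e1 e2
    have := h1 j
    have := (h1 j).symm
    simp_all
  rw [edgeFun_eq_one_iff] at hi hj
  rcases hi with rfl | rfl <;> rcases hj with hj | hj
  · have := congrFun hj (σ i)
    simp only [Pi.single_apply] at this
    by_contra hne
    simp_all
  · exact absurd hj (key i j)
  · exact absurd hj.symm (key j i)
  · have e1 := congrFun hj i
    have e2 := congrFun hj (σ i)
    simp only [Pi.add_apply, Pi.single_apply] at e1 e2
    have := h1 i
    have := (h1 i).symm
    have := h2 j
    by_contra hne
    simp_all

/-- The map adding to each coordinate in `K` the indicator of its edge. -/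
def edgeSwap (σ : Equiv.Perm ι) (K : Finset ι) (x : ι → Z2) : ι → Z2 := fun i =>
  x i + if i ∈ K then edgeFun σ i x else 0

theorem edgeSwap_involutive (h1 : ∀ i, σ i ≠ i) (h2 : ∀ i, σ (σ i) ≠ i) (K : Finset ι) :
    Function.Involutive (edgeSwap σ K) := by
  intro x
  by_cases hx : ∃ i ∈ K, edgeFun σ i x = 1
  · obtain ⟨i, hiK, hi⟩ := hx
    have step : ∀ y, edgeFun σ i y = 1 → edgeSwap σ K y = y + Pi.single i 1 := by
      intro y hy
      funext j
      by_cases hj : j = i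
      · subst hj
        simp [edgeSwap, hiK, hy]
      · have : edgeFun σ j y = 0 := (edgeFun_eq_zero_or_one j y).resolve_right
          fun h => hj (edgeFun_disjoint h1 h2 h hy)
        simp [edgeSwap, this, hj]
    rw [step x hi, step _ (edgeFun_add_single hi), add_assoc, ← Pi.single_add,
      CharTwo.add_self_eq_zero, Pi.single_zero, add_zero]
  · have : edgeSwap σ K x = x := by
      funext j
      by_cases hj : j ∈ K
      · have : edgeFun σ j x = 0 := (edgeFun_eq_zero_or_one j x).resolve_right
          fun h => hx ⟨j, hj, h⟩
        simp [edgeSwap, this]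
      · simp [edgeSwap, hj]
    rw [this, this]

theorem edgeFun_independent (h1 : ∀ i, σ i ≠ i) (h2 : ∀ i, σ (σ i) ≠ i) {c : Z2} {a b : ι → Z2}
    (h : ∀ x, c + ∑ i, a i * x i + ∑ i, b i * edgeFun σ i x = 0) : c = 0 ∧ a = 0 ∧ b = 0 := by
  have hc : c = 0 := by simpa [edgeFun_zero _ (h1 _)] using h 0
  subst hc
  have hsum : ∀ i x, edgeFun σ i x = 1 → ∑ j, b j * edgeFun σ j x = b i := by
    intro i x hx
    rw [Finset.sum_eq_single i, hx, mul_one]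
    · intro j _ hj
      rw [(edgeFun_eq_zero_or_one j x).resolve_right
        fun h => hj (edgeFun_disjoint h1 h2 h hx), mul_zero]
    · simp
  have e1 : ∀ i, a (σ i) + b i = 0 := by
    intro i
    have := h (Pi.single (σ i) 1)
    rw [hsum i _ (edgeFun_eq_one_iff.2 (Or.inl rfl))] at this
    simpa [Pi.single_apply] using this
  have e2 : ∀ i, a i + a (σ i) + b i = 0 := by
    intro i
    have := h (Pi.single i 1 + Pi.single (σ i) 1)
    rw [hsum i _ (edgeFun_eq_one_iff.2 (Or.inr rfl))] at this
    simpa [Pi.single_apply, mul_add, Finset.sum_add_distrib] using this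
  have ha : ∀ i, a i = 0 := fun i => by simpa [add_assoc, e1 i] using e2 i
  exact ⟨rfl, funext ha, funext fun i => by simpa [ha] using e1 i⟩

end Edges

/-- On `2^n ≥ 8` points there are `n` coordinate functions `e i` together with perturbations `f i`
which are jointly affinely independent, such that perturbing any subset of the coordinates yields
again a system of coordinates. -/
theorem exists_coordinates {n : ℕ} (hn : 3 ≤ n) : ∃ e f : Fin n → Fin (2 ^ n) → Z2,
    (∀ (c : Z2) (a b : Fin n → Z2),
      (∀ p, c + ∑ i, a i * e i p + ∑ i, b i * f i p = 0) → c = 0 ∧ a = 0 ∧ b = 0) ∧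
    ∀ K : Finset (Fin n),
      Function.Bijective fun p i => e i p + if i ∈ K then f i p else 0 := by
  obtain ⟨m, rfl⟩ : ∃ m, n = m + 3 := ⟨n - 3, by omega⟩
  let σ := finRotate (m + 3)
  have h1 : ∀ i, σ i ≠ i := by
    intro i h
    simp [σ] at h
  have h2 : ∀ i, σ (σ i) ≠ i := by
    intro i h
    have := i.isLt
    simp only [σ, finRotate_apply, Fin.ext_iff, Fin.val_add, Fin.val_one] at h
    rcases Nat.lt_or_ge (i.val + 1) (m + 3) with h3 | h3
    · rw [Nat.mod_eq_of_lt h3] at h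
      rcases Nat.lt_or_ge (i.val + 1 + 1) (m + 3) with h4 | h4
      · rw [Nat.mod_eq_of_lt h4] at h
        omega
      · rw [Nat.mod_eq_sub_mod h4, Nat.mod_eq_of_lt (by omega)] at h
        omega
    · rw [Nat.mod_eq_sub_mod h3, Nat.mod_eq_of_lt (a := i.val + 1 - (m + 3)) (by omega),
        Nat.mod_eq_of_lt (by omega)] at h
      omega
  let E : Fin (2 ^ (m + 3)) ≃ (Fin (m + 3) → Z2) := Fintype.equivOfCardEq (by simp)
  refine ⟨fun i p => E p i, fun i p => edgeFun σ i (E p), fun c a b h => ?_, fun K => ?_⟩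
  · exact edgeFun_independent h1 h2 fun x => by simpa using h (E.symm x)
  · exact (edgeSwap_involutive h1 h2 K).bijective.comp E.bijective

/-- The Lee weight on `Z₄`. -/
def leeWeight (z : Z4) : ℕ := if z = 0 then 0 else if z = 2 then 2 else 1

theorem hammingDist_grayMap {N : ℕ} (u v : Amb 0 N) :
    hammingDist (grayMap u) (grayMap v) = ∑ j, leeWeight (u.2 j - v.2 j) := by
  have key : ∀ y z : Z4, (if (grayPhi y).1 ≠ (grayPhi z).1 then 1 else 0) +
      (if (grayPhi y).2 ≠ (grayPhi z).2 then 1 else 0) = leeWeight (y - z) := by decide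
  rw [hammingDist, Finset.card_filter, Fintype.sum_sum_type, Fintype.sum_prod_type]
  simp only [Finset.univ_eq_empty, Finset.sum_empty, zero_add]
  refine Finset.sum_congr rfl fun j _ => ?_
  rw [Fin.sum_univ_two, ← key]
  simp [grayMap]

theorem grayMap_injective {N : ℕ} : Function.Injective (grayMap (α := 0) (β := N)) := by
  intro u v h
  have h0 := hammingDist_grayMap u v
  rw [h, hammingDist_self, eq_comm, Finset.sum_eq_zero_iff] at h0
  have hz : ∀ z, leeWeight z = 0 → z = 0 := by decide
  exact Prod.ext (Subsingleton.elim _ _)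
    (funext fun j => sub_eq_zero.1 (hz _ (h0 j (Finset.mem_univ j))))

theorem four_le_sum_leeWeight {N : ℕ} {D : AddSubgroup (Amb 0 N)}
    (hone : ((0, fun _ => 1) : Amb 0 N) ∈ D) (hsep : ∀ i j, (∀ d ∈ D, d.2 i = d.2 j) → i = j)
    {u : Amb 0 N} (hu : u ∈ dualCode D) (hu0 : u ≠ 0) : 4 ≤ ∑ j, leeWeight (u.2 j) := by
  classical
  have hsum : ∑ j, u.2 j = 0 := by
    have := hu _ hone
    rw [addInner_eq_sum] at this
    simpa using this
  have heven : 2 ∣ ∑ j, leeWeight (u.2 j) := by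
    have hred : ∀ z : Z4, ((leeWeight z : ℕ) : Z2) = red z := by decide
    rw [← ZMod.natCast_eq_zero_iff, Nat.cast_sum, Finset.sum_congr rfl fun j _ => hred (u.2 j),
      ← map_sum, hsum, map_zero]
  set S := Finset.univ.filter fun j => u.2 j ≠ 0 with hS
  have hle : S.card ≤ ∑ j, leeWeight (u.2 j) := by
    rw [hS, Finset.card_filter]
    have hz : ∀ z : Z4, (if z ≠ 0 then 1 else 0) ≤ leeWeight z := by decide
    exact Finset.sum_le_sum fun j _ => hz _
  have hsupp : ∀ g : Fin N → Z4, ∑ j, u.2 j * g j = ∑ j ∈ S, u.2 j * g j := by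
    intro g
    rw [hS, Finset.sum_filter]
    refine Finset.sum_congr rfl fun j _ => ?_
    by_cases hj : u.2 j = 0 <;> simp [hj]
  by_contra hlt
  have h3 : S.card = 0 ∨ S.card = 1 ∨ S.card = 2 := by omega
  rcases h3 with h | h | h
  · refine hu0 (Prod.ext (Subsingleton.elim _ _) (funext fun j => ?_))
    by_contra hj
    have : j ∈ S := by simpa [hS] using hj
    rw [Finset.card_eq_zero.1 h] at this
    simp at this
  · obtain ⟨j, hj⟩ := Finset.card_eq_one.1 h
    have hj0 : u.2 j ≠ 0 := by
      have : j ∈ S := by simp [hj]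
      simpa [hS] using this
    have := hsupp fun _ => 1
    rw [hj] at this
    simp [hsum] at this
    exact hj0 this.symm
  · obtain ⟨i, j, hij, hSij⟩ := Finset.card_eq_two.1 h
    have hi0 : u.2 i ≠ 0 := by
      have : i ∈ S := by simp [hSij]
      simpa [hS] using this
    have hneg : u.2 i + u.2 j = 0 := by
      have := hsupp fun _ => 1
      rw [hSij, Finset.sum_pair hij] at this
      simpa [hsum] using this.symm
    have hlee : leeWeight (u.2 i) + leeWeight (u.2 j) < 4 := by
      rw [← Finset.sum_pair (f := fun j => leeWeight (u.2 j)) hij]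
      exact lt_of_le_of_lt (Finset.sum_le_univ_sum_of_nonneg fun _ => Nat.zero_le _)
        (not_le.1 hlt)
    refine hij (hsep i j fun d hd => ?_)
    have hd0 := hu d hd
    rw [addInner_eq_sum, hsupp, hSij, Finset.sum_pair hij] at hd0
    have key : ∀ y z b c : Z4, y ≠ 0 → y + z = 0 → leeWeight y + leeWeight z < 4 →
        y * b + z * c = 0 → b = c := by decide
    exact key _ _ _ _ hi0 hneg hlee hd0

theorem isQuatPerfect_dualCode {t : ℕ} (ht : 3 ≤ t) {D : AddSubgroup (Amb 0 (2 ^ (t - 1)))}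
    (hcard : Nat.card D = 2 ^ (t + 1)) (hone : ((0, fun _ => 1) : Amb 0 (2 ^ (t - 1))) ∈ D)
    (hsep : ∀ i j, (∀ d ∈ D, d.2 i = d.2 j) → i = j)
    (hpar : ∃ i j, i ≠ j ∧ ∀ d ∈ D, red (d.2 i) = red (d.2 j)) :
    isQuatPerfect t (2 ^ (t - 1)) (dualCode D) := by
  refine ⟨ht, rfl, ?_, ?_, ?_⟩
  · rw [Nat.card_image_of_injective grayMap_injective]
    have hmul := card_dualCode_mul_card D
    have hlt : t < 2 ^ t := Nat.lt_two_pow_self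
    have h2 : 2 * 2 ^ (t - 1) = 2 ^ t := by
      rw [← pow_succ', Nat.sub_add_cancel (by omega)]
    have h4 : 4 ^ 2 ^ (t - 1) = 2 ^ (2 * 2 ^ (t - 1)) := by rw [pow_mul]; norm_num
    have hsplit : 2 * 2 ^ (t - 1) = (2 * 2 ^ (t - 1) - t - 1) + (t + 1) := by omega
    rw [hcard, h4, hsplit, pow_add 2 _ (t + 1)] at hmul
    exact Nat.eq_of_mul_eq_mul_right (Nat.two_pow_pos (t + 1)) hmul
  · rintro _ ⟨u, hu, rfl⟩ _ ⟨v, hv, rfl⟩ hne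
    rw [hammingDist_grayMap]
    refine four_le_sum_leeWeight hone hsep (u := u - v) (sub_mem hu hv) ?_
    rintro h
    exact hne (congrArg grayMap (sub_eq_zero.1 h))
  · obtain ⟨i, j, hij, hd⟩ := hpar
    let u : Amb 0 (2 ^ (t - 1)) := (0, Pi.single i 2 + Pi.single j 2)
    have h2 : leeWeight 2 = 2 := by decide
    have hlee : ∀ k, leeWeight (u.2 k) = (if k = i then 2 else 0) + if k = j then 2 else 0 := by
      intro k
      by_cases hi : k = i
      · subst hi
        simp [u, hij, h2]
      · by_cases hj : k = j
        · subst hj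
          simp [u, hi, h2]
        · simp [u, hi, hj, leeWeight]
    have hdist : hammingDist (grayMap u) (grayMap 0) = 4 := by
      simp [hammingDist_grayMap, hlee, Finset.sum_add_distrib]
    refine ⟨grayMap u, ⟨u, fun d hdD => ?_, rfl⟩, grayMap 0, ⟨0, zero_mem _, rfl⟩, ?_, hdist⟩
    · have key : ∀ y z : Z4, red y = red z → 2 * y + 2 * z = 0 := by decide
      rw [addInner_eq_sum]
      simpa [u, add_mul, Finset.sum_add_distrib, Pi.single_apply] using key _ _ (hd d hdD)
    · rintro h
      rw [h, hammingDist_self] at hdist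
      omega

section Hadamard

variable {n N : ℕ}

/-- The code generated by the all-one word, the words `g i + 2 u i` for `i ∈ A`, the words `2 g i`
for `i ∈ B` and the words `2 f i` for `i ∈ K`. -/
def hadCode (g u f : Fin n → Fin N → Z2) (A B K : Finset (Fin n)) : AddSubgroup (Amb 0 N) :=
  genCode (ι := Option A) (κ := B ⊕ K)
    (fun o => o.elim (fun _ => 1) fun i p => lift (g i p) + dbl (u i p))
    (Sum.elim (fun i => g i) fun i => f i)

section Membership

variable {g u f : Fin n → Fin N → Z2} {A B K : Finset (Fin n)}

theorem one_mem_hadCode : ((0, fun _ => 1) : Amb 0 N) ∈ hadCode g u f A B K :=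
  AddSubgroup.subset_closure (Or.inl ⟨none, rfl⟩)

theorem lift_add_dbl_mem_hadCode {i : Fin n} (hi : i ∈ A) :
    ((0, fun p => lift (g i p) + dbl (u i p)) : Amb 0 N) ∈ hadCode g u f A B K :=
  AddSubgroup.subset_closure (Or.inl ⟨some ⟨i, hi⟩, rfl⟩)

theorem dbl_mem_hadCode_of_mem_right {i : Fin n} (hi : i ∈ B) :
    ((0, fun p => dbl (g i p)) : Amb 0 N) ∈ hadCode g u f A B K :=
  AddSubgroup.subset_closure (Or.inr ⟨Sum.inl ⟨i, hi⟩, rfl⟩)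

theorem dbl_extra_mem_hadCode {i : Fin n} (hi : i ∈ K) :
    ((0, fun p => dbl (f i p)) : Amb 0 N) ∈ hadCode g u f A B K :=
  AddSubgroup.subset_closure (Or.inr ⟨Sum.inr ⟨i, hi⟩, rfl⟩)

theorem dbl_mem_hadCode_of_mem_left {i : Fin n} (hi : i ∈ A) :
    ((0, fun p => dbl (g i p)) : Amb 0 N) ∈ hadCode g u f A B K := by
  have h := lift_add_dbl_mem_hadCode (g := g) (u := u) (f := f) (B := B) (K := K) hi
  convert add_mem h h using 1
  refine Prod.ext (Subsingleton.elim _ _) (funext fun p => ?_)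
  have key : ∀ x y : Z2, dbl x = lift x + dbl y + (lift x + dbl y) := by decide
  exact key _ _

theorem hadCode_le {X : AddSubgroup (Amb 0 N)} (hone : ((0, fun _ => 1) : Amb 0 N) ∈ X)
    (hA : ∀ i ∈ A, ((0, fun p => lift (g i p) + dbl (u i p)) : Amb 0 N) ∈ X)
    (hB : ∀ i ∈ B, ((0, fun p => dbl (g i p)) : Amb 0 N) ∈ X)
    (hK : ∀ i ∈ K, ((0, fun p => dbl (f i p)) : Amb 0 N) ∈ X) : hadCode g u f A B K ≤ X := by
  rw [hadCode, genCode, AddSubgroup.closure_le]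
  rintro _ (⟨_ | ⟨i, hi⟩, rfl⟩ | ⟨⟨i, hi⟩ | ⟨i, hi⟩, rfl⟩)
  exacts [hone, hA i hi, hB i hi, hK i hi]

end Membership

/-- Extension by zero of a function on a finite subset. -/
def extendZero (A : Finset (Fin n)) (a : A → Z2) (i : Fin n) : Z2 :=
  if h : i ∈ A then a ⟨i, h⟩ else 0

theorem sum_extendZero (A : Finset (Fin n)) (a : A → Z2) (w : Fin n → Z2) :
    ∑ i, extendZero A a i * w i = ∑ i : A, a i * w i := by
  have h1 : ∑ i : A, a i * w i = ∑ i : A, extendZero A a i * w i :=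
    Finset.sum_congr rfl fun i _ => by simp [extendZero]
  rw [h1, Finset.sum_coe_sort A fun i => extendZero A a i * w i]
  refine (Finset.sum_subset (Finset.subset_univ A) fun i _ hi => ?_).symm
  simp [extendZero, hi]

theorem eq_zero_of_extendZero {A : Finset (Fin n)} {a : A → Z2}
    (h : ∀ i ∈ A, extendZero A a i = 0) : a = 0 :=
  funext fun i => by simpa [extendZero] using h i i.2

theorem isOfType_hadCode {e f : Fin n → Fin N → Z2}
    (hind : ∀ (c : Z2) (a b : Fin n → Z2),
      (∀ p, c + ∑ i, a i * e i p + ∑ i, b i * f i p = 0) → c = 0 ∧ a = 0 ∧ b = 0)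
    (u : Fin n → Fin N → Z2) (L : Finset (Fin n)) {A B : Finset (Fin n)} (hAB : Disjoint A B)
    (K : Finset (Fin n)) :
    isOfType (hadCode (fun i p => e i p + if i ∈ L then f i p else 0) u f A B K)
      (B.card + K.card) (A.card + 1) := by
  have hcA : A.card + 1 = Fintype.card (Option A) := by simp
  have hcB : B.card + K.card = Fintype.card (B ⊕ K) := by simp
  rw [hcA, hcB]
  refine isOfType_genCode fun a b h => ?_
  set a' := extendZero A fun i => a (some i) with ha'
  set b' := extendZero B fun i => b (Sum.inl i) with hb'
  set k' := extendZero K fun i => b (Sum.inr i) with hk'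
  obtain ⟨h0, h1, h2⟩ := hind (a none) (fun i => a' i + b' i)
    (fun i => (a' i + b' i) * (if i ∈ L then 1 else 0) + k' i) fun p => by
      refine Eq.trans ?_ (h p)
      simp only [Fintype.sum_option, Fintype.sum_sum_type, Option.elim, Sum.elim_inl, Sum.elim_inr,
        map_add, red_lift, red_dbl, add_zero, map_one, mul_one]
      rw [← sum_extendZero A (fun i => a (some i)) (fun i => e i p + if i ∈ L then f i p else 0),
        ← sum_extendZero B (fun i => b (Sum.inl i)) (fun i => e i p + if i ∈ L then f i p else 0),
        ← sum_extendZero K (fun i => b (Sum.inr i)) (fun i => f i p), ← ha', ← hb', ← hk']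
      simp only [add_assoc, ← Finset.sum_add_distrib]
      congr 1
      refine Finset.sum_congr rfl fun i _ => ?_
      split_ifs <;> ring
  have hab : ∀ i, a' i + b' i = 0 := fun i => congrFun h1 i
  have hk : ∀ i, k' i = 0 := fun i => by simpa [hab i] using congrFun h2 i
  have hA0 := eq_zero_of_extendZero (A := A) (a := fun i => a (some i)) fun i hi => by
    have hb0 : b' i = 0 := by simp [hb', extendZero, Finset.disjoint_left.1 hAB hi]
    simpa [hb0] using hab i
  have hB0 := eq_zero_of_extendZero (A := B) (a := fun i => b (Sum.inl i)) fun i hi => by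
    have ha0 : a' i = 0 := by simp [ha', extendZero, Finset.disjoint_right.1 hAB hi]
    simpa [ha0] using hab i
  have hK0 := eq_zero_of_extendZero (A := K) (a := fun i => b (Sum.inr i)) fun i _ => hk i
  refine ⟨funext ?_, funext ?_⟩
  · rintro (_ | i)
    exacts [h0, congrFun hA0 i]
  · rintro (i | i)
    exacts [congrFun hB0 i, congrFun hK0 i]

/-- The dual of `D` has minimum distance four: `D` contains the all-one word, separates
the coordinate positions, and does not do so modulo two. -/
def IsHadamardLike (D : AddSubgroup (Amb 0 N)) : Prop :=
  ((0, fun _ => 1) : Amb 0 N) ∈ D ∧ (∀ i j, (∀ d ∈ D, d.2 i = d.2 j) → i = j) ∧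
    ∃ i j, i ≠ j ∧ ∀ d ∈ D, red (d.2 i) = red (d.2 j)

theorem isHadamardLike_hadCode (hn : 0 < n) {g f : Fin n → Fin N → Z2}
    (hg : Function.Bijective fun p i => g i p) {A U : Finset (Fin n)} {τ : Fin n → Fin n}
    (hτ : Set.SurjOn τ A U) (hτU : Set.MapsTo τ A U) (hAU : Disjoint A U) :
    IsHadamardLike (hadCode g (fun i => g (τ i)) f A (A ∪ U)ᶜ ∅) := by
  refine ⟨one_mem_hadCode, fun p q h => ?_, ?_⟩
  · have hdbl : ∀ x y, dbl x = dbl y → x = y := by decide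
    have hA : ∀ i ∈ A, g i p = g i q := fun i hi => by
      have := congrArg red (h _ (lift_add_dbl_mem_hadCode hi))
      simpa [red_lift, red_dbl] using this
    refine hg.injective (funext fun i => ?_)
    by_cases hiA : i ∈ A
    · exact hA i hiA
    by_cases hiU : i ∈ U
    · obtain ⟨j, hj, rfl⟩ := hτ hiU
      have := h _ (lift_add_dbl_mem_hadCode hj)
      simp only [hA j hj] at this
      exact hdbl _ _ (add_left_cancel this)
    · exact hdbl _ _ (h _ (dbl_mem_hadCode_of_mem_right (by simp [hiA, hiU])))
  · obtain ⟨m, hm⟩ : ∃ m, m ∉ A := by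
      by_contra! hall
      exact Finset.disjoint_left.1 hAU (hall _) (hτU (hall ⟨0, hn⟩))
    obtain ⟨p, hp⟩ := hg.surjective 0
    obtain ⟨q, hq⟩ := hg.surjective (Pi.single m 1)
    refine ⟨p, q, ?_, ?_⟩
    · rintro rfl
      have := congrFun (hp.symm.trans hq) m
      simp at this
    · let φ : Fin N → Amb 0 N →+ Z2 := fun i =>
        red.toAddMonoidHom.comp ((Pi.evalAddMonoidHom _ i).comp (AddMonoidHom.snd _ _))
      have hle : hadCode g (fun i => g (τ i)) f A (A ∪ U)ᶜ ∅ ≤ (φ p).eqLocus (φ q) := by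
        refine hadCode_le rfl (fun i hi => ?_) (fun i _ => ?_) (by simp)
        · change red (lift (g i p) + dbl _) = red (lift (g i q) + dbl _)
          have h1 : g i p = 0 := congrFun hp i
          have h2 : g i q = 0 := by
            have := congrFun hq i
            rwa [Pi.single_eq_of_ne (ne_of_mem_of_not_mem hi hm)] at this
          simp [red_dbl, h1, h2]
        · change red (dbl _) = red (dbl _)
          rw [red_dbl, red_dbl]
      exact fun d hd => hle hd

end Hadamard

section Sum

variable {N : ℕ} {X : AddSubgroup (Amb 0 N)} {h a b : Fin N → Z2}

theorem dbl_add_mem (ha : ((0, fun p => dbl (a p)) : Amb 0 N) ∈ X)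
    (hb : ((0, fun p => dbl (b p)) : Amb 0 N) ∈ X) :
    ((0, fun p => dbl (a p + b p)) : Amb 0 N) ∈ X := by
  convert add_mem ha hb using 1
  exact Prod.ext (Subsingleton.elim _ _) (funext fun p => map_add _ _ _)

theorem lift_add_dbl_add_mem (ha : ((0, fun p => lift (h p) + dbl (a p)) : Amb 0 N) ∈ X)
    (hb : ((0, fun p => dbl (b p)) : Amb 0 N) ∈ X) :
    ((0, fun p => lift (h p) + dbl (a p + b p)) : Amb 0 N) ∈ X := by
  convert add_mem ha hb using 1
  refine Prod.ext (Subsingleton.elim _ _) (funext fun p => ?_)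
  change lift (h p) + dbl (a p + b p) = lift (h p) + dbl (a p) + dbl (b p)
  rw [map_add, add_assoc]

theorem dbl_add_mem_of_lift (ha : ((0, fun p => lift (h p) + dbl (a p)) : Amb 0 N) ∈ X)
    (hb : ((0, fun p => lift (h p) + dbl (b p)) : Amb 0 N) ∈ X) :
    ((0, fun p => dbl (a p + b p)) : Amb 0 N) ∈ X := by
  convert sub_mem ha hb using 1
  refine Prod.ext (Subsingleton.elim _ _) (funext fun p => ?_)
  have key : ∀ x y z : Z2, dbl (x + y) = lift z + dbl x - (lift z + dbl y) := by decide
  exact key _ _ _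

end Sum

/-- The coordinate functions `e i`, perturbed by `f i` for `i ∈ L`. -/
def perturb {n N : ℕ} (e f : Fin n → Fin N → Z2) (L : Finset (Fin n)) : Fin n → Fin N → Z2 :=
  fun i p => e i p + if i ∈ L then f i p else 0

theorem perturb_congr {n N : ℕ} (e f : Fin n → Fin N → Z2) {L M : Finset (Fin n)} {i : Fin n}
    (h : i ∈ L ↔ i ∈ M) : perturb e f L i = perturb e f M i := by
  funext p
  simp [perturb, h]

theorem perturb_add {n N : ℕ} (e f : Fin n → Fin N → Z2) {L M : Finset (Fin n)} {i : Fin n}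
    (hL : i ∈ L) (hM : i ∉ M) (p : Fin N) :
    perturb e f L i p + perturb e f M i p = f i p := by
  have key : ∀ x y : Z2, x + y + x = y := by decide
  simp [perturb, hL, hM, key]

theorem dbl_perturb_mem {n N : ℕ} {e f : Fin n → Fin N → Z2} {L M : Finset (Fin n)} {i : Fin n}
    {X : AddSubgroup (Amb 0 N)} (h : ((0, fun p => dbl (perturb e f L i p)) : Amb 0 N) ∈ X)
    (hf : (i ∈ L ∨ i ∈ M) → ((0, fun p => dbl (f i p)) : Amb 0 N) ∈ X) :
    ((0, fun p => dbl (perturb e f M i p)) : Amb 0 N) ∈ X := by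
  by_cases hLM : i ∈ L ↔ i ∈ M
  · rwa [← perturb_congr e f hLM]
  · have hsum := dbl_add_mem h (hf (by tauto))
    convert hsum using 6 with p
    have key : ∀ x y : Z2, x = x + y + y ∧ x + y = x + 0 + y := by decide
    by_cases hL : i ∈ L
    · have hM : i ∉ M := by tauto
      simp [perturb, hL, hM, ← (key _ _).1]
    · have hM : i ∈ M := by tauto
      simp [perturb, hL, hM]

section Arrangement

variable {n N : ℕ} {e f : Fin n → Fin N → Z2} {A₁ A₂ U₁ U₂ K : Finset (Fin n)}
  {τ₁ τ₂ : Fin n → Fin n}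

theorem hadCode_sup_hadCode (hτ₁ : Set.MapsTo τ₁ A₁ U₁)
    (hτ : ∀ i ∈ A₁ ∩ A₂, τ₁ i = τ₂ i ∧ i ∉ K)
    (hK : ∀ i ∈ K, (i ∉ U₁ ∧ i ∉ U₂) ∨ ∃ j ∈ A₁ ∩ A₂, τ₁ j = i) :
    hadCode (perturb e f K) (fun i => perturb e f K (τ₁ i)) f A₁ (A₁ ∪ U₁)ᶜ ∅ ⊔
        hadCode (perturb e f ∅) (fun i => perturb e f ∅ (τ₂ i)) f A₂ (A₂ ∪ U₂)ᶜ ∅ =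
      hadCode (perturb e f (K ∩ A₁))
        (fun i => if i ∈ A₁ then perturb e f K (τ₁ i) else perturb e f ∅ (τ₂ i)) f
        (A₁ ∪ A₂) (A₁ ∪ A₂ ∪ U₁ ∩ U₂)ᶜ K := by
  set D₁ := hadCode (perturb e f K) (fun i => perturb e f K (τ₁ i)) f A₁ (A₁ ∪ U₁)ᶜ ∅ with hD₁
  set D₂ := hadCode (perturb e f ∅) (fun i => perturb e f ∅ (τ₂ i)) f A₂ (A₂ ∪ U₂)ᶜ ∅ with hD₂
  set D := hadCode (perturb e f (K ∩ A₁))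
    (fun i => if i ∈ A₁ then perturb e f K (τ₁ i) else perturb e f ∅ (τ₂ i)) f
    (A₁ ∪ A₂) (A₁ ∪ A₂ ∪ U₁ ∩ U₂)ᶜ K with hD
  have hle₁ : D₁ ≤ D₁ ⊔ D₂ := le_sup_left
  have hle₂ : D₂ ≤ D₁ ⊔ D₂ := le_sup_right
  have hdbl₁ : ∀ i ∉ U₁, ((0, fun p => dbl (perturb e f K i p)) : Amb 0 N) ∈ D₁ := by
    intro i hi
    by_cases hiA : i ∈ A₁
    · exact dbl_mem_hadCode_of_mem_left hiA
    · exact dbl_mem_hadCode_of_mem_right (by simp [hi, hiA])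
  have hdbl₂ : ∀ i ∉ U₂, ((0, fun p => dbl (perturb e f ∅ i p)) : Amb 0 N) ∈ D₂ := by
    intro i hi
    by_cases hiA : i ∈ A₂
    · exact dbl_mem_hadCode_of_mem_left hiA
    · exact dbl_mem_hadCode_of_mem_right (by simp [hi, hiA])
  have hf : ∀ i ∈ K, ((0, fun p => dbl (f i p)) : Amb 0 N) ∈ D := fun i hi =>
    dbl_extra_mem_hadCode hi
  have hdbl : ∀ L ⊆ K, ∀ i, (i ∉ U₁ ∨ i ∉ U₂) →
      ((0, fun p => dbl (perturb e f L i p)) : Amb 0 N) ∈ D := by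
    intro L hL i hi
    refine dbl_perturb_mem (L := K ∩ A₁) ?_ fun h => hf i ?_
    · by_cases hiA : i ∈ A₁ ∪ A₂
      · exact dbl_mem_hadCode_of_mem_left hiA
      · refine dbl_mem_hadCode_of_mem_right ?_
        simp only [Finset.mem_compl, Finset.mem_union, Finset.mem_inter] at hiA ⊢
        tauto
    · exact h.elim (fun h => (Finset.mem_inter.1 h).1) fun h => hL h
  apply le_antisymm
  · refine sup_le (hadCode_le one_mem_hadCode ?_ ?_ (by simp))
      (hadCode_le one_mem_hadCode ?_ ?_ (by simp))
    · intro i hi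
      have h := lift_add_dbl_mem_hadCode (g := perturb e f (K ∩ A₁))
        (u := fun i => if i ∈ A₁ then perturb e f K (τ₁ i) else perturb e f ∅ (τ₂ i))
        (f := f) (B := (A₁ ∪ A₂ ∪ U₁ ∩ U₂)ᶜ) (K := K) (Finset.mem_union_left A₂ hi)
      rwa [perturb_congr e f (show i ∈ K ∩ A₁ ↔ i ∈ K by simp [hi]), if_pos hi] at h
    · intro i hi
      simp only [Finset.mem_compl, Finset.mem_union, not_or] at hi
      exact hdbl K subset_rfl i (Or.inl hi.2)
    · intro i hi
      have h := lift_add_dbl_mem_hadCode (g := perturb e f (K ∩ A₁))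
        (u := fun i => if i ∈ A₁ then perturb e f K (τ₁ i) else perturb e f ∅ (τ₂ i))
        (f := f) (B := (A₁ ∪ A₂ ∪ U₁ ∩ U₂)ᶜ) (K := K) (Finset.mem_union_right A₁ hi)
      by_cases hi₁ : i ∈ A₁
      · obtain ⟨hτi, hiK⟩ := hτ i (Finset.mem_inter.2 ⟨hi₁, hi⟩)
        rw [perturb_congr e f (show i ∈ K ∩ A₁ ↔ i ∈ (∅ : Finset _) by simp [hiK]),
          if_pos hi₁] at h
        rw [← hτi]
        by_cases hK' : τ₁ i ∈ K
        · convert lift_add_dbl_add_mem h (hf _ hK') using 6 with p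
          rw [← perturb_add e f hK' (Finset.notMem_empty _) p, ← add_assoc,
            CharTwo.add_self_eq_zero, zero_add]
        · rwa [perturb_congr e f (show τ₁ i ∈ K ↔ τ₁ i ∈ (∅ : Finset _) by simp [hK'])] at h
      · rwa [perturb_congr e f (show i ∈ K ∩ A₁ ↔ i ∈ (∅ : Finset _) by simp [hi₁]),
          if_neg hi₁] at h
    · intro i hi
      simp only [Finset.mem_compl, Finset.mem_union, not_or] at hi
      exact hdbl ∅ (Finset.empty_subset K) i (Or.inr hi.2)
  · refine hadCode_le (hle₁ one_mem_hadCode) ?_ ?_ ?_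
    · intro i hi
      by_cases hi₁ : i ∈ A₁
      · rw [perturb_congr e f (show i ∈ K ∩ A₁ ↔ i ∈ K by simp [hi₁]), if_pos hi₁]
        exact hle₁ (lift_add_dbl_mem_hadCode hi₁)
      · rw [perturb_congr e f (show i ∈ K ∩ A₁ ↔ i ∈ (∅ : Finset _) by simp [hi₁]), if_neg hi₁]
        exact hle₂ (lift_add_dbl_mem_hadCode ((Finset.mem_union.1 hi).resolve_left hi₁))
    · intro i hi
      simp only [Finset.mem_compl, Finset.mem_union, Finset.mem_inter, not_or, not_and] at hi
      rw [perturb_congr e f (show i ∈ K ∩ A₁ ↔ i ∈ (∅ : Finset _) by simp [hi.1.1])]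
      by_cases hi₂ : i ∈ U₂
      · have hi₁ : i ∉ U₁ := fun h => hi.2 h hi₂
        have hiK : i ∉ K := by
          intro hiK
          rcases hK i hiK with h | ⟨j, hj, rfl⟩
          · exact h.2 hi₂
          · exact hi₁ (hτ₁ (Finset.mem_inter.1 hj).1)
        rw [← perturb_congr e f (show i ∈ K ↔ i ∈ (∅ : Finset _) by simp [hiK])]
        exact hle₁ (hdbl₁ i hi₁)
      · exact hle₂ (hdbl₂ i hi₂)
    · intro i hi
      have hsum : ((0, fun p => dbl (perturb e f K i p + perturb e f ∅ i p)) : Amb 0 N) ∈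
          D₁ ⊔ D₂ := by
        rcases hK i hi with h | ⟨j, hj, rfl⟩
        · exact dbl_add_mem (hle₁ (hdbl₁ i h.1)) (hle₂ (hdbl₂ i h.2))
        · obtain ⟨hτj, hjK⟩ := hτ j hj
          obtain ⟨hj₁, hj₂⟩ := Finset.mem_inter.1 hj
          refine dbl_add_mem_of_lift (h := perturb e f ∅ j) ?_ ?_
          · rw [← perturb_congr e f (show j ∈ K ↔ j ∈ (∅ : Finset _) by simp [hjK])]
            exact hle₁ (lift_add_dbl_mem_hadCode hj₁)
          · rw [hτj]
            exact hle₂ (lift_add_dbl_mem_hadCode hj₂)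
      simpa only [perturb_add e f hi (Finset.notMem_empty i)] using hsum

/-- Codes realising a prescribed arrangement: `A₁`, `A₂` index the generators of order four, whose
second bits are the coordinates in `U₁`, `U₂`, and `K` indexes the perturbed coordinates. -/
theorem exists_codes_of_arrangement (hn : 3 ≤ n)
    (hτ₁ : Set.MapsTo τ₁ A₁ U₁) (hτ₁' : Set.SurjOn τ₁ A₁ U₁) (hU₁ : U₁.card = A₁.card)
    (hτ₂ : Set.MapsTo τ₂ A₂ U₂) (hτ₂' : Set.SurjOn τ₂ A₂ U₂) (hU₂ : U₂.card = A₂.card)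
    (hA₁ : Disjoint A₁ U₁) (hA₂ : Disjoint A₂ U₂)
    (hτ : ∀ i ∈ A₁ ∩ A₂, τ₁ i = τ₂ i ∧ i ∉ K)
    (hK : ∀ i ∈ K, (i ∉ U₁ ∧ i ∉ U₂) ∨ ∃ j ∈ A₁ ∩ A₂, τ₁ j = i) :
    ∃ D₁ D₂ : AddSubgroup (Amb 0 (2 ^ n)), IsHadamardLike D₁ ∧ IsHadamardLike D₂ ∧
      isOfType D₁ (n - 2 * A₁.card) (A₁.card + 1) ∧ isOfType D₂ (n - 2 * A₂.card) (A₂.card + 1) ∧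
      isOfType (D₁ ⊔ D₂) (n - ((A₁ ∪ A₂).card + (U₁ ∩ U₂).card) + K.card)
        ((A₁ ∪ A₂).card + 1) := by
  obtain ⟨e, f, hind, hbij⟩ := exists_coordinates hn
  have hcard : ∀ {A U : Finset (Fin n)}, U.card = A.card → Disjoint A U →
      n - 2 * A.card = (A ∪ U)ᶜ.card + (∅ : Finset (Fin n)).card := by
    intro A U hU hAU
    rw [Finset.card_compl, Finset.card_union_of_disjoint hAU, hU, Fintype.card_fin,
      Finset.card_empty]
    omega
  have hdisj : ∀ {A U : Finset (Fin n)}, Disjoint A (A ∪ U)ᶜ := fun {A U} =>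
    Finset.disjoint_left.2 fun i hi => by simp [hi]
  have hAU : Disjoint (A₁ ∪ A₂) (U₁ ∩ U₂) := by
    rw [Finset.disjoint_union_left]
    exact ⟨hA₁.mono_right Finset.inter_subset_left, hA₂.mono_right Finset.inter_subset_right⟩
  refine ⟨hadCode (perturb e f K) (fun i => perturb e f K (τ₁ i)) f A₁ (A₁ ∪ U₁)ᶜ ∅,
    hadCode (perturb e f ∅) (fun i => perturb e f ∅ (τ₂ i)) f A₂ (A₂ ∪ U₂)ᶜ ∅,
    isHadamardLike_hadCode (by omega) (hbij K) hτ₁' hτ₁ hA₁,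
    isHadamardLike_hadCode (by omega) (hbij ∅) hτ₂' hτ₂ hA₂, ?_, ?_, ?_⟩
  · rw [hcard hU₁ hA₁]
    exact isOfType_hadCode hind _ K hdisj ∅
  · rw [hcard hU₂ hA₂]
    exact isOfType_hadCode hind _ ∅ hdisj ∅
  · rw [hadCode_sup_hadCode hτ₁ hτ hK, ← Finset.card_union_of_disjoint hAU]
    have hc := Finset.card_compl (A₁ ∪ A₂ ∪ U₁ ∩ U₂)
    rw [Fintype.card_fin] at hc
    rw [← hc]
    exact isOfType_hadCode hind _ (K ∩ A₁) hdisj K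

end Arrangement

/-- The elements of `Fin n` in one of two half-open intervals. -/
def twoIntervals (n l₁ h₁ l₂ h₂ : ℕ) : Finset (Fin n) :=
  Finset.univ.filter fun i => (l₁ ≤ i.val ∧ i.val < h₁) ∨ (l₂ ≤ i.val ∧ i.val < h₂)

theorem mem_twoIntervals {n l₁ h₁ l₂ h₂ : ℕ} {i : Fin n} : i ∈ twoIntervals n l₁ h₁ l₂ h₂ ↔
    (l₁ ≤ i.val ∧ i.val < h₁) ∨ (l₂ ≤ i.val ∧ i.val < h₂) := by
  simp [twoIntervals]

theorem card_twoIntervals {n l₁ h₁ l₂ h₂ : ℕ} (h : h₁ ≤ l₂) (h' : h₁ ≤ n) (hn : h₂ ≤ n) :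
    (twoIntervals n l₁ h₁ l₂ h₂).card = (h₁ - l₁) + (h₂ - l₂) := by
  have himage : (twoIntervals n l₁ h₁ l₂ h₂).map Fin.valEmbedding =
      Finset.Ico l₁ h₁ ∪ Finset.Ico l₂ h₂ := by
    ext m
    simp only [Finset.mem_map, mem_twoIntervals, Fin.valEmbedding_apply, Finset.mem_union,
      Finset.mem_Ico]
    constructor
    · rintro ⟨i, hi, rfl⟩
      exact hi
    · intro hm
      exact ⟨⟨m, by omega⟩, hm, rfl⟩
  have hdisj : Disjoint (Finset.Ico l₁ h₁) (Finset.Ico l₂ h₂) :=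
    Finset.disjoint_left.2 fun m hm hm' => by
      rw [Finset.mem_Ico] at hm hm'
      omega
  rw [← Finset.card_map Fin.valEmbedding, himage, Finset.card_union_of_disjoint hdisj,
    Nat.card_Ico, Nat.card_Ico]

theorem exists_map_of_injOn {n : ℕ} {A U : Finset (Fin n)} (F : ℕ → ℕ)
    (hF : ∀ i ∈ A, ∃ j ∈ U, j.val = F i) (hinj : ∀ i ∈ A, ∀ j ∈ A, F i = F j → i = j)
    (hcard : U.card = A.card) : ∃ τ : Fin n → Fin n, (∀ i ∈ A, (τ i).val = F i) ∧
      Set.MapsTo τ A U ∧ Set.SurjOn τ A U := by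
  choose! τ hτU hτF using hF
  refine ⟨τ, hτF, hτU, Finset.surjOn_of_injOn_of_card_le τ hτU (fun i hi j hj hij => ?_) hcard.le⟩
  exact hinj i hi j hj (by rw [← hτF i hi, ← hτF j hj, hij])

theorem exists_arrangement {n a b s c k : ℕ} (ha : 2 * a ≤ n) (hb : 2 * b ≤ n) (hsc : s ≤ c)
    (hca : c ≤ a) (hcb : c ≤ b) (habc : a + b + c ≤ n + s)
    (hk : k = 0 ∨ c = s ∧ k + a + b ≤ n + s) :
    ∃ (A₁ A₂ U₁ U₂ K : Finset (Fin n)) (τ₁ τ₂ : Fin n → Fin n),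
      Set.MapsTo τ₁ A₁ U₁ ∧ Set.SurjOn τ₁ A₁ U₁ ∧ U₁.card = a ∧
      Set.MapsTo τ₂ A₂ U₂ ∧ Set.SurjOn τ₂ A₂ U₂ ∧ U₂.card = b ∧
      Disjoint A₁ U₁ ∧ Disjoint A₂ U₂ ∧
      (∀ i ∈ A₁ ∩ A₂, τ₁ i = τ₂ i ∧ i ∉ K) ∧
      (∀ i ∈ K, (i ∉ U₁ ∧ i ∉ U₂) ∨ ∃ j ∈ A₁ ∩ A₂, τ₁ j = i) ∧
      A₁.card = a ∧ A₂.card = b ∧ (A₁ ∪ A₂).card = a + b - s ∧ (U₁ ∩ U₂).card = c ∧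
      K.card = k := by
  obtain ⟨A₁, hA₁⟩ : ∃ A, A = twoIntervals n 0 s (s + c) (c + a) := ⟨_, rfl⟩
  obtain ⟨A₂, hA₂⟩ : ∃ A, A = twoIntervals n 0 s (n + s - b) n := ⟨_, rfl⟩
  obtain ⟨U₁, hU₁⟩ : ∃ A, A = twoIntervals n s (s + c) (n + c - a) n := ⟨_, rfl⟩
  obtain ⟨U₂, hU₂⟩ : ∃ A, A = twoIntervals n s (s + b) n n := ⟨_, rfl⟩
  have hA₁c : A₁.card = a := by
    rw [hA₁, card_twoIntervals] <;> omega
  have hA₂c : A₂.card = b := by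
    rw [hA₂, card_twoIntervals] <;> omega
  have hU₁c : U₁.card = a := by
    rw [hU₁, card_twoIntervals] <;> omega
  have hU₂c : U₂.card = b := by
    rw [hU₂, card_twoIntervals] <;> omega
  have hAA : A₁ ∩ A₂ = twoIntervals n 0 s n n := by
    ext i
    have := i.isLt
    rw [hA₁, hA₂, Finset.mem_inter, mem_twoIntervals, mem_twoIntervals, mem_twoIntervals]
    omega
  have hUU : U₁ ∩ U₂ = twoIntervals n s (s + c) n n := by
    ext i
    have := i.isLt
    rw [hU₁, hU₂, Finset.mem_inter, mem_twoIntervals, mem_twoIntervals, mem_twoIntervals]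
    omega
  obtain ⟨τ₁, hτ₁, hm₁, hs₁⟩ := exists_map_of_injOn (A := A₁) (U := U₁)
    (fun i => if i < s then s + i else if i < 2 * c then i + s - c else i + n - a - c)
    (fun i hi => by
      rw [hA₁, mem_twoIntervals] at hi
      have hlt : (if i.val < s then s + i else if i.val < 2 * c then i + s - c
          else i + n - a - c) < n := by
        split_ifs <;> omega
      refine ⟨⟨_, hlt⟩, hU₁ ▸ mem_twoIntervals.2 ?_, rfl⟩
      dsimp only
      split_ifs <;> omega)
    (fun i hi j hj hij => by
      rw [hA₁, mem_twoIntervals] at hi hj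
      refine Fin.ext ?_
      split_ifs at hij <;> omega)
    (hU₁c.trans hA₁c.symm)
  obtain ⟨τ₂, hτ₂, hm₂, hs₂⟩ := exists_map_of_injOn (A := A₂) (U := U₂)
    (fun i => if i < s then s + i else i + s + b - n)
    (fun i hi => by
      have := i.isLt
      rw [hA₂, mem_twoIntervals] at hi
      have hlt : (if i.val < s then s + i else i + s + b - n) < n := by
        split_ifs <;> omega
      refine ⟨⟨_, hlt⟩, hU₂ ▸ mem_twoIntervals.2 ?_, rfl⟩
      dsimp only
      split_ifs <;> omega)
    (fun i hi j hj hij => by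
      rw [hA₂, mem_twoIntervals] at hi hj
      refine Fin.ext ?_
      split_ifs at hij <;> omega)
    (hU₂c.trans hA₂c.symm)
  obtain ⟨K, hKsub, hKc⟩ : ∃ K : Finset (Fin n),
      (∀ i ∈ K, c = s ∧ i ∈ twoIntervals n s (2 * s) (s + b) (n + c - a)) ∧ K.card = k := by
    rcases hk with rfl | ⟨hcs, hk⟩
    · exact ⟨∅, by simp, rfl⟩
    · obtain ⟨K, hK, hKc⟩ := Finset.exists_subset_card_eq
        (s := twoIntervals n s (2 * s) (s + b) (n + c - a)) (n := k) (by
          rw [card_twoIntervals] <;> omega)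
      exact ⟨K, fun i hi => ⟨hcs, hK hi⟩, hKc⟩
  refine ⟨A₁, A₂, U₁, U₂, K, τ₁, τ₂, hm₁, hs₁, hU₁c, hm₂, hs₂, hU₂c, ?_, ?_, ?_, ?_, hA₁c, hA₂c,
    ?_, ?_, hKc⟩
  · refine Finset.disjoint_left.2 fun i hi hi' => ?_
    rw [hA₁, mem_twoIntervals] at hi
    rw [hU₁, mem_twoIntervals] at hi'
    omega
  · refine Finset.disjoint_left.2 fun i hi hi' => ?_
    rw [hA₂, mem_twoIntervals] at hi
    rw [hU₂, mem_twoIntervals] at hi'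
    omega
  · intro i hi
    obtain ⟨hi₁, hi₂⟩ := Finset.mem_inter.1 hi
    rw [hAA, mem_twoIntervals] at hi
    have hlt : i.val < s := by omega
    refine ⟨Fin.ext ?_, fun hiK => ?_⟩
    · rw [hτ₁ i hi₁, hτ₂ i hi₂, if_pos hlt, if_pos hlt]
    · have := (hKsub i hiK).2
      rw [mem_twoIntervals] at this
      omega
  · intro i hiK
    obtain ⟨hcs, hi⟩ := hKsub i hiK
    rw [mem_twoIntervals] at hi
    rcases hi with hi | hi
    · right
      have hj : (⟨i.val - s, by omega⟩ : Fin n) ∈ A₁ ∩ A₂ := by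
        rw [hAA, mem_twoIntervals]
        dsimp only
        omega
      refine ⟨_, hj, Fin.ext ?_⟩
      rw [hτ₁ _ (Finset.mem_inter.1 hj).1]
      dsimp only
      rw [if_pos (by omega)]
      omega
    · left
      rw [hU₁, hU₂, mem_twoIntervals, mem_twoIntervals]
      omega
  · have hunion := Finset.card_union_add_card_inter A₁ A₂
    have hinter : (A₁ ∩ A₂).card = s := by
      rw [hAA, card_twoIntervals] <;> omega
    omega
  · rw [hUU, card_twoIntervals] <;> omega

/-- for `t ≥ 4`, all admissible dual types of intersections of two
quaternary linear perfect codes of length `2^(t-1)` are attained. -/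
theorem stmt12 {t γ₁ δ₁ γ₂ δ₂ γ δ : ℕ} (ht : 4 ≤ t)
    (h1 : γ₁ + 2 * δ₁ = t + 1) (h2 : γ₂ + 2 * δ₂ = t + 1)
    (hδ₁ : 1 ≤ δ₁) (hδ₂ : 1 ≤ δ₂)
    (hδl : max δ₁ δ₂ ≤ δ) (hδu : δ + 1 ≤ δ₁ + δ₂)
    (hγl : max δ (max (γ₁ + δ₁) (γ₂ + δ₂)) ≤ γ + δ)
    (hγu : γ + δ + 1 ≤ γ₁ + γ₂ + δ₁ + δ₂) :
    ∃ C₁ C₂ : AddSubgroup (Amb 0 (2 ^ (t - 1))),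
      isQuatPerfect t (2 ^ (t - 1)) C₁ ∧ isQuatPerfect t (2 ^ (t - 1)) C₂ ∧
      isOfType (dualCode C₁) γ₁ δ₁ ∧ isOfType (dualCode C₂) γ₂ δ₂ ∧
      isOfType (dualCode (C₁ ⊓ C₂)) γ δ := by
  obtain ⟨n, rfl⟩ : ∃ n, t = n + 1 := ⟨t - 1, by omega⟩
  obtain ⟨a, rfl⟩ : ∃ a, δ₁ = a + 1 := ⟨δ₁ - 1, by omega⟩
  obtain ⟨b, rfl⟩ : ∃ b, δ₂ = b + 1 := ⟨δ₂ - 1, by omega⟩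
  obtain ⟨d, rfl⟩ : ∃ d, δ = d + 1 := ⟨δ - 1, by omega⟩
  obtain ⟨s, hs⟩ : ∃ s, d + s = a + b := ⟨a + b - d, by omega⟩
  simp only [max_le_iff] at hδl hγl
  obtain ⟨c, k, hsc, hca, hcb, habc, hk, hγ⟩ : ∃ c k, s ≤ c ∧ c ≤ a ∧ c ≤ b ∧
      a + b + c ≤ n + s ∧ (k = 0 ∨ c = s ∧ k + a + b ≤ n + s) ∧ γ + d + c = n + k := by
    rcases Nat.le_total (γ + d + s) n with h | h
    · exact ⟨n - (γ + d), 0, by omega⟩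
    · exact ⟨s, γ + d + s - n, by omega⟩
  obtain ⟨A₁, A₂, U₁, U₂, K, τ₁, τ₂, hm₁, hs₁, hU₁, hm₂, hs₂, hU₂, hd₁, hd₂, hτ, hK, hA₁, hA₂,
    hAA, hUU, hKc⟩ := exists_arrangement (n := n) (by omega) (by omega) hsc hca hcb habc hk
  obtain ⟨D₁, D₂, hD₁, hD₂, ht₁, ht₂, ht₃⟩ := exists_codes_of_arrangement (by omega) hm₁ hs₁
    (hU₁.trans hA₁.symm) hm₂ hs₂ (hU₂.trans hA₂.symm) hd₁ hd₂ hτ hK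
  rw [hA₁, show n - 2 * a = γ₁ by omega] at ht₁
  rw [hA₂, show n - 2 * b = γ₂ by omega] at ht₂
  rw [hAA, hUU, hKc, show a + b - s = d by omega, show n - (d + c) + k = γ by omega] at ht₃
  refine ⟨dualCode D₁, dualCode D₂,
    isQuatPerfect_dualCode (by omega) ?_ hD₁.1 hD₁.2.1 hD₁.2.2,
    isQuatPerfect_dualCode (by omega) ?_ hD₂.1 hD₂.2.1 hD₂.2.2, ?_, ?_, ?_⟩
  · rw [← h1]
    exact ht₁.1
  · rw [← h2]
    exact ht₂.1
  · rw [dualCode_dualCode]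
    exact ht₁
  · rw [dualCode_dualCode]
    exact ht₂
  · rw [← dualCode_sup, dualCode_dualCode]
    exact ht₃
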